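/- arXiv:solv-int/9911002 — 4 statements merged into one kernel-verified Lean document; each statement's English description precedes it below -/
import Mathlib

section
/- Let g ≥ 1 be an integer and let B be a symmetric g×g complex matrix whose imaginary part is positive definite. Then for every z ∈ ℂ^g the series Σ_{m∈ℤ^g} exp(πi⟨Bm,m⟩ + 2πi⟨z,m⟩) defining the theta function Θ(z|B) is (absolutely) summable. -/
open Complex Finset Matrix Real

set_option autoImplicit false

/-- Bilinear pairing `⟨x,y⟩ = ∑ j, x j * y j` on `ℂ^g` (no conjugation). -/
noncomputable def cPair {g : ℕ} (x y : Fin g → ℂ) : ℂ := ∑ j, x j * y j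

/-- The `m`-th term of the theta series:
`exp (π i ⟨B m, m⟩ + 2 π i ⟨z, m⟩)`. -/
noncomputable def thetaTerm {g : ℕ} (B : Matrix (Fin g) (Fin g) ℂ)
    (z : Fin g → ℂ) (m : Fin g → ℤ) : ℂ :=
  Complex.exp (π * I * cPair (B.mulVec (fun j => (m j : ℂ))) (fun j => (m j : ℂ)) +
    2 * π * I * cPair z (fun j => (m j : ℂ)))

/-- The `g`-dimensional theta function `Θ(z|B)`. -/
noncomputable def Theta {g : ℕ} (z : Fin g → ℂ) (B : Matrix (Fin g) (Fin g) ℂ) : ℂ :=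
  ∑' m : Fin g → ℤ, thetaTerm B z m

lemma summable_prod_pi_aux (n : ℕ) : ∀ (f : Fin n → ℤ → ℝ), (∀ j k, 0 ≤ f j k) →
    (∀ j, Summable (f j)) → Summable (fun m : Fin n → ℤ => ∏ j, f j (m j)) := by
  induction n with
  | zero => intro f _ _; exact (hasSum_fintype _).summable
  | succ n ih =>
    intro f h0 hs
    have h1 := ih (fun j => f j.succ) (fun j k => h0 _ _) (fun j => hs _)
    have h2 := (hs 0).mul_of_nonneg h1 (fun k => h0 0 k)
      (fun m => Finset.prod_nonneg fun j _ => h0 _ _)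
    rw [← (Fin.consEquiv (fun _ : Fin (n+1) => ℤ)).summable_iff]
    refine h2.congr fun p => ?_
    simp [Fin.prod_univ_succ, Fin.consEquiv]

lemma posDef_lower_aux {g : ℕ} (hg : 1 ≤ g) (A : Matrix (Fin g) (Fin g) ℝ) (hA : A.PosDef) :
    ∃ c : ℝ, 0 < c ∧ ∀ x : Fin g → ℝ, c * ∑ j, x j ^ 2 ≤ ∑ j, (A.mulVec x) j * x j := by
  have : Nonempty (Fin g) := ⟨⟨0, hg⟩⟩
  have hcont : Continuous (fun x : Fin g → ℝ => ∑ j, (A.mulVec x) j * x j) := by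
    simp only [Matrix.mulVec, dotProduct]
    fun_prop
  have hpos : ∀ x : Fin g → ℝ, x ≠ 0 → 0 < ∑ j, (A.mulVec x) j * x j := by
    intro x hx
    have := hA.dotProduct_mulVec_pos hx
    simpa [dotProduct, mul_comm] using this
  obtain ⟨x0, hx0, hmin⟩ := (isCompact_sphere (0 : Fin g → ℝ) 1).exists_isMinOn
    (NormedSpace.sphere_nonempty.2 zero_le_one) hcont.continuousOn
  have hx0' : x0 ≠ 0 := by
    rintro rfl
    simp at hx0
  have hc := hpos x0 hx0'
  set c := ∑ j, (A.mulVec x0) j * x0 j with hcdef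
  have hg' : (0 : ℝ) < g := by exact_mod_cast hg
  refine ⟨c / g, by positivity, fun x => ?_⟩
  by_cases hx : x = 0
  · subst hx; simp
  have hn : 0 < ‖x‖ := norm_pos_iff.2 hx
  have h1 : c ≤ ∑ j, (A.mulVec (‖x‖⁻¹ • x)) j * (‖x‖⁻¹ • x) j := by
    apply hmin
    simp [norm_smul, hn.ne']
  have h2 : ∑ j, (A.mulVec (‖x‖⁻¹ • x)) j * (‖x‖⁻¹ • x) j
      = (‖x‖ ^ 2)⁻¹ * ∑ j, (A.mulVec x) j * x j := by
    rw [Matrix.mulVec_smul, Finset.mul_sum]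
    refine Finset.sum_congr rfl fun j _ => ?_
    simp only [Pi.smul_apply, smul_eq_mul]
    field_simp
  rw [h2, le_inv_mul_iff₀ (by positivity)] at h1
  have h3 : ∑ j, x j ^ 2 ≤ g * ‖x‖ ^ 2 := by
    calc ∑ j, x j ^ 2 ≤ ∑ j : Fin g, ‖x‖ ^ 2 := by
          refine Finset.sum_le_sum fun j _ => ?_
          rw [← sq_abs]
          have := norm_le_pi_norm x j
          rw [Real.norm_eq_abs] at this
          gcongr
      _ = _ := by simp
  calc c / g * ∑ j, x j ^ 2 ≤ c / g * (g * ‖x‖ ^ 2) := by gcongr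
    _ = ‖x‖ ^ 2 * c := by field_simp
    _ ≤ _ := h1

/-- For `g ≥ 1` and a symmetric `g×g` complex matrix `B` with
positive definite imaginary part, the theta series is (absolutely) summable
for every `z ∈ ℂ^g`. -/
theorem theta_summable (g : ℕ) (hg : 1 ≤ g) (B : Matrix (Fin g) (Fin g) ℂ)
    (hB : B.IsSymm) (hIm : (B.map Complex.im).PosDef) (z : Fin g → ℂ) :
    Summable (thetaTerm B z) := by
  obtain ⟨c, hc, hle⟩ := posDef_lower_aux hg _ hIm
  have hs : ∀ j : Fin g, Summable (fun n : ℤ => ‖jacobiTheta₂_term n (z j) (c * I)‖) := fun j =>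
    ((summable_jacobiTheta₂_term_iff (z j) (c * I)).2 (by simpa using hc)).norm
  refine Summable.of_norm_bounded
    (summable_prod_pi_aux g (fun j n => ‖jacobiTheta₂_term n (z j) (c * I)‖)
      (fun _ _ => norm_nonneg _) hs) fun m => ?_
  simp only [norm_jacobiTheta₂_term, ← Real.exp_sum]
  rw [thetaTerm, Complex.norm_exp, Real.exp_le_exp]
  have hx := hle (fun j => (m j : ℝ))
  have e1 : (cPair (B.mulVec (fun j => (m j : ℂ))) (fun j => (m j : ℂ))).im
      = ∑ j, ((B.map Complex.im).mulVec (fun j => (m j : ℝ))) j * (m j : ℝ) := by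
    simp [cPair, Matrix.mulVec, dotProduct, Complex.im_sum]
  have e2 : (cPair z (fun j => (m j : ℂ))).im = ∑ j, (z j).im * (m j : ℝ) := by
    simp [cPair, Complex.im_sum]
  have e3 : ∀ w v : ℂ, (π * I * w + 2 * π * I * v).re = -π * w.im - 2 * π * v.im := by
    intro w v; simp; ring
  rw [e3, e1, e2]
  have e4 : ∑ j, (-π * (m j : ℝ) ^ 2 * ((c : ℂ) * I).im - 2 * π * (m j : ℝ) * (z j).im)
      = -π * (c * ∑ j, (m j : ℝ) ^ 2) - 2 * π * ∑ j, (z j).im * (m j : ℝ) := by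
    simp only [Finset.mul_sum, ← Finset.sum_sub_distrib]
    refine Finset.sum_congr rfl fun j _ => ?_
    simp; ring
  rw [e4]
  have := mul_le_mul_of_nonneg_left hx Real.pi_pos.le
  linarith
end

section
/- Let g ≥ 1 be an integer and let B be a symmetric g×g complex matrix whose imaginary part is positive definite. Then the function z ↦ Θ(z|B) is holomorphic (complex analytic) on all of ℂ^g. -/
open Complex Finset Matrix Real

set_option autoImplicit false

lemma expSeries_analytic {E ι : Type*} [NormedAddCommGroup E] [NormedSpace ℂ E]
    (c : ι → ℂ) (l : ι → E →L[ℂ] ℂ)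
    (h : ∀ r : ℝ, 0 ≤ r → Summable (fun i => ‖c i‖ * Real.exp (r * ‖l i‖))) :
    AnalyticOnNhd ℂ (fun z => ∑' i, c i * Complex.exp (l i z)) Set.univ := by
  let q : (n : ℕ) → ι → ContinuousMultilinearMap ℂ (fun _ : Fin n => E) ℂ := fun n i =>
    (c i / (n.factorial : ℂ)) •
      (ContinuousMultilinearMap.mkPiAlgebraFin ℂ n ℂ).compContinuousLinearMap (fun _ => l i)
  have hq : ∀ n i, ‖q n i‖ ≤ ‖c i‖ * (‖l i‖ ^ n / n.factorial) := by
    intro n i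
    have h1 := ContinuousMultilinearMap.norm_compContinuousLinearMap_le
      (ContinuousMultilinearMap.mkPiAlgebraFin ℂ n ℂ) (fun _ => l i)
    simp only [ContinuousMultilinearMap.norm_mkPiAlgebraFin, one_mul, Finset.prod_const,
      Finset.card_univ, Fintype.card_fin] at h1
    calc ‖q n i‖ = ‖c i / (n.factorial : ℂ)‖ * _ := norm_smul _ _
      _ ≤ ‖c i / (n.factorial : ℂ)‖ * ‖l i‖ ^ n := by gcongr
      _ = _ := by simp [norm_div]; ring
  have hqr : ∀ (r : ℝ), 0 ≤ r → ∀ n i, ‖q n i‖ * r ^ n ≤ ‖c i‖ * Real.exp (r * ‖l i‖) := by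
    intro r hr n i
    calc ‖q n i‖ * r ^ n ≤ ‖c i‖ * (‖l i‖ ^ n / n.factorial) * r ^ n := by
          gcongr; exact hq n i
      _ = ‖c i‖ * ((r * ‖l i‖) ^ n / n.factorial) := by rw [mul_pow]; ring
      _ ≤ _ := by
          gcongr
          exact Real.pow_div_factorial_le_exp _ (by positivity) n
  have hqs : ∀ n, Summable (fun i => ‖q n i‖) := by
    intro n
    refine Summable.of_nonneg_of_le (fun _ => norm_nonneg _) (fun i => ?_) (h 1 zero_le_one)
    simpa using hqr 1 zero_le_one n i
  let p : FormalMultilinearSeries ℂ E ℂ := fun n => ∑' i, q n i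
  have hp : HasFPowerSeriesOnBall (fun z => ∑' i, c i * Complex.exp (l i z)) p 0 ⊤ := by
    refine ⟨?_, by simp, ?_⟩
    · refine ENNReal.le_of_forall_nnreal_lt fun r _ => ?_
      refine p.le_radius_of_bound (∑' i, ‖c i‖ * Real.exp (r * ‖l i‖)) fun n => ?_
      calc ‖p n‖ * (r : ℝ) ^ n ≤ (∑' i, ‖q n i‖) * (r : ℝ) ^ n := by
            gcongr; exact norm_tsum_le_tsum_norm (hqs n)
        _ = ∑' i, ‖q n i‖ * (r : ℝ) ^ n := tsum_mul_right.symm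
        _ ≤ _ := Summable.tsum_le_tsum (hqr r r.2 n) ((hqs n).mul_right _) (h r r.2)
    · intro y _
      have hpy : ∀ n, p n (fun _ => y) = ∑' i, c i * ((l i y) ^ n / n.factorial) := by
        intro n
        have h2 := (hqs n).of_norm.hasSum
        have h3 := h2.mapL (ContinuousMultilinearMap.apply ℂ (fun _ : Fin n => E) ℂ (fun _ => y))
        change ContinuousMultilinearMap.apply ℂ (fun _ : Fin n => E) ℂ (fun _ => y) (p n) = _
        rw [← h3.tsum_eq]
        refine tsum_congr fun i => ?_
        simp [q]
        ring
      have hexp : ∀ i, HasSum (fun n : ℕ => c i * ((l i y) ^ n / n.factorial))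
          (c i * Complex.exp (l i y)) := by
        intro i
        rw [Complex.exp_eq_exp_ℂ]
        exact (NormedSpace.expSeries_div_hasSum_exp (l i y)).mul_left _
      have hS : Summable (fun x : ι × ℕ => c x.1 * ((l x.1 y) ^ x.2 / x.2.factorial)) := by
        apply Summable.of_norm
        have hn : ∀ i, HasSum (fun n : ℕ => ‖c i * ((l i y) ^ n / n.factorial)‖)
            (‖c i‖ * Real.exp ‖l i y‖) := by
          intro i
          rw [Real.exp_eq_exp_ℝ]
          have := (NormedSpace.expSeries_div_hasSum_exp (‖l i y‖)).mul_left ‖c i‖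
          simpa using this
        rw [summable_prod_of_nonneg (fun _ => norm_nonneg _)]
        refine ⟨fun i => (hn i).summable, ?_⟩
        simp only [fun i => (hn i).tsum_eq]
        refine Summable.of_nonneg_of_le (fun _ => by positivity) (fun i => ?_)
          (h ‖y‖ (norm_nonneg _))
        gcongr
        rw [mul_comm]
        exact (l i).le_opNorm y
      simp only [hpy, zero_add]
      have hS' := (Equiv.prodComm ℕ ι).summable_iff.mpr hS
      have h4 : Summable (fun n : ℕ => ∑' i, c i * ((l i y) ^ n / n.factorial)) := hS'.prod
      have h5 : ∑' n : ℕ, ∑' i, c i * ((l i y) ^ n / n.factorial)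
          = ∑' i, c i * Complex.exp (l i y) := by
        rw [← tsum_congr fun i => (hexp i).tsum_eq]
        exact Summable.tsum_comm hS
      rw [← h5]
      exact h4.hasSum
  have := hp.analyticOnNhd
  simpa using this

lemma summable_pi_prod_int (f : ℤ → ℝ) (hf : Summable f) (h0 : ∀ n, 0 ≤ f n) (g : ℕ) :
    Summable (fun m : Fin g → ℤ => ∏ j, f (m j)) := by
  induction g with
  | zero => exact Summable.of_finite
  | succ n ih =>
    rw [← (Fin.consEquiv (fun _ : Fin (n + 1) => ℤ)).summable_iff]
    have := hf.mul_of_nonneg ih h0 (fun m => Finset.prod_nonneg fun _ _ => h0 _)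
    refine this.congr fun x => ?_
    simp [Fin.prod_univ_succ, Fin.consEquiv]

lemma posDef_lower {g : ℕ} (hg : 1 ≤ g) (Y : Matrix (Fin g) (Fin g) ℝ) (hY : Y.PosDef) :
    ∃ δ : ℝ, 0 < δ ∧ ∀ x : Fin g → ℝ, δ * ∑ j, x j ^ 2 ≤ x ⬝ᵥ (Y *ᵥ x) := by
  have hcont : Continuous (fun x : Fin g → ℝ => x ⬝ᵥ (Y *ᵥ x)) := by
    simp only [dotProduct, mulVec]; fun_prop
  obtain ⟨d, hd, hd'⟩ := (isCompact_sphere (0 : Fin g → ℝ) 1).exists_forall_le'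
    (f := fun x : Fin g → ℝ => x ⬝ᵥ (Y *ᵥ x)) hcont.continuousOn (a := 0) (by
      intro x hx
      have hx0 : x ≠ 0 := by
        rintro rfl
        simp at hx
      simpa using hY.dotProduct_mulVec_pos hx0)
  have hg' : (0 : ℝ) < g := by exact_mod_cast hg
  refine ⟨d / g, by positivity, fun x => ?_⟩
  by_cases hx : x = 0
  · subst hx; simp
  have hn : 0 < ‖x‖ := norm_pos_iff.mpr hx
  have h1 := hd' (‖x‖⁻¹ • x) (by simp [norm_smul, hn.ne'])
  simp only [mulVec_smul, dotProduct_smul, smul_dotProduct, smul_eq_mul] at h1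
  have h2 : d * ‖x‖ ^ 2 ≤ x ⬝ᵥ (Y *ᵥ x) := by
    calc d * ‖x‖ ^ 2 ≤ (‖x‖⁻¹ * (‖x‖⁻¹ * (x ⬝ᵥ (Y *ᵥ x)))) * ‖x‖ ^ 2 := by gcongr
      _ = _ := by field_simp
  have h3 : ∑ j, x j ^ 2 ≤ g * ‖x‖ ^ 2 := by
    calc ∑ j, x j ^ 2 ≤ ∑ j : Fin g, ‖x‖ ^ 2 := by
          refine Finset.sum_le_sum fun j _ => ?_
          rw [← sq_abs]
          gcongr
          exact norm_le_pi_norm x j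
      _ = _ := by simp
  calc d / g * ∑ j, x j ^ 2 ≤ d / g * (g * ‖x‖ ^ 2) := by gcongr
    _ = d * ‖x‖ ^ 2 := by field_simp
    _ ≤ _ := h2

/-- For `g ≥ 1` and a symmetric `g×g` complex matrix `B` with
positive definite imaginary part, `z ↦ Θ(z|B)` is holomorphic (complex
analytic) on all of `ℂ^g`. -/
theorem theta_analytic (g : ℕ) (hg : 1 ≤ g) (B : Matrix (Fin g) (Fin g) ℂ)
    (hB : B.IsSymm) (hIm : (B.map Complex.im).PosDef) :
    AnalyticOnNhd ℂ (fun z : Fin g → ℂ => Theta z B) Set.univ := by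
  obtain ⟨δ, hδ, hδ'⟩ := posDef_lower hg _ hIm
  let c : (Fin g → ℤ) → ℂ := fun m =>
    Complex.exp (π * I * cPair (B.mulVec (fun j => (m j : ℂ))) (fun j => (m j : ℂ)))
  let l : (Fin g → ℤ) → (Fin g → ℂ) →L[ℂ] ℂ := fun m =>
    ∑ j, (2 * π * I * (m j : ℂ)) • ContinuousLinearMap.proj (R := ℂ) (φ := fun _ : Fin g => ℂ) j
  have hl : ∀ m z, l m z = 2 * π * I * cPair z (fun j => (m j : ℂ)) := by
    intro m z
    simp only [l, cPair, ContinuousLinearMap.sum_apply, ContinuousLinearMap.smul_apply,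
      ContinuousLinearMap.proj_apply, smul_eq_mul, Finset.mul_sum]
    exact Finset.sum_congr rfl fun j _ => by ring
  have hln : ∀ m, ‖l m‖ ≤ ∑ j, 2 * π * |(m j : ℝ)| := by
    intro m
    refine ContinuousLinearMap.opNorm_le_bound _ (by positivity) fun z => ?_
    rw [hl, cPair, Finset.mul_sum, Finset.sum_mul]
    refine (norm_sum_le _ _).trans (Finset.sum_le_sum fun j _ => ?_)
    have : ‖z j‖ ≤ ‖z‖ := norm_le_pi_norm z j
    simp only [norm_mul, Complex.norm_I, Complex.norm_real, Complex.norm_intCast,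
      Complex.norm_ofNat, Real.norm_eq_abs, abs_of_pos Real.pi_pos]
    calc 2 * π * 1 * (‖z j‖ * |(m j : ℝ)|) = 2 * π * |(m j : ℝ)| * ‖z j‖ := by ring
      _ ≤ _ := by gcongr
  have hcn : ∀ m, ‖c m‖ ≤ Real.exp (-π * (δ * ∑ j, (m j : ℝ) ^ 2)) := by
    intro m
    have him : (cPair (B.mulVec (fun j => (m j : ℂ))) (fun j => (m j : ℂ))).im =
        (fun j => (m j : ℝ)) ⬝ᵥ ((B.map Complex.im) *ᵥ (fun j => (m j : ℝ))) := by
      simp only [cPair, dotProduct, mulVec, Complex.im_sum, Complex.mul_im, Complex.intCast_im,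
        Complex.intCast_re, mul_zero, zero_add, Matrix.map_apply]
      exact Finset.sum_congr rfl fun j _ => by rw [mul_comm]
    have h1 := hδ' (fun j => (m j : ℝ))
    simp only [c, Complex.norm_exp]
    rw [← him] at h1
    apply Real.exp_le_exp.mpr
    have : (π * I * cPair (B.mulVec (fun j => (m j : ℂ))) (fun j => (m j : ℂ))).re =
      -π * (cPair (B.mulVec (fun j => (m j : ℂ))) (fun j => (m j : ℂ))).im := by
      simp
    rw [this]
    have := Real.pi_pos
    nlinarith
  have key := expSeries_analytic c l (by
    intro r hr
    have hs := summable_pow_mul_jacobiTheta₂_term_bound r hδ 0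
    simp only [pow_zero, one_mul] at hs
    refine Summable.of_nonneg_of_le (fun _ => by positivity) (fun m => ?_)
      (summable_pi_prod_int _ hs (fun _ => (Real.exp_pos _).le) g)
    calc ‖c m‖ * Real.exp (r * ‖l m‖)
        ≤ Real.exp (-π * (δ * ∑ j, (m j : ℝ) ^ 2)) *
          Real.exp (r * ∑ j, 2 * π * |(m j : ℝ)|) := by
          gcongr
          · exact hcn m
          · exact hln m
      _ = _ := by
          rw [← Real.exp_add, ← Real.exp_sum]
          congr 1
          simp only [Finset.mul_sum, ← Finset.sum_add_distrib]
          exact Finset.sum_congr rfl fun j _ => by push_cast; ring)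
  have heq : (fun z : Fin g → ℂ => Theta z B) = fun z => ∑' m, c m * Complex.exp (l m z) := by
    funext z
    refine tsum_congr fun m => ?_
    rw [thetaTerm, Complex.exp_add, hl]
  rw [heq]
  exact key
end

section
/- Let g ≥ 1 be an integer, let B be a symmetric g×g complex matrix whose imaginary part is positive definite, and let f_j = B e_j ∈ ℂ^g be the j-th column of B. Then for every z ∈ ℂ^g and every j, Θ(z + f_j | B) = exp(−πi B_{jj} − 2πi z_j) · Θ(z|B). -/
open Complex Finset Matrix Real

set_option autoImplicit false

/-- with `f_j = B e_j` the `j`-th column of `B`,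
`Θ(z + f_j | B) = exp (−π i B_{jj} − 2 π i z_j) · Θ(z | B)`. -/
theorem theta_quasiperiodic (g : ℕ) (hg : 1 ≤ g) (B : Matrix (Fin g) (Fin g) ℂ)
    (hB : B.IsSymm) (hIm : (B.map Complex.im).PosDef) (z : Fin g → ℂ) (j : Fin g) :
    Theta (z + B.mulVec (Pi.single j 1)) B =
      Complex.exp (-(π * I * B j j) - 2 * π * I * z j) * Theta z B := by
  unfold Theta
  rw [← tsum_mul_left, ← (Equiv.addRight (Pi.single j (1 : ℤ))).tsum_eq
    (fun m => Complex.exp (-(π * I * B j j) - 2 * π * I * z j) * thetaTerm B z m)]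
  refine tsum_congr fun m => ?_
  have hc : (fun k => (((Equiv.addRight (Pi.single j (1 : ℤ))) m k : ℤ) : ℂ))
      = (fun k => (m k : ℂ)) + Pi.single j 1 := by
    funext k
    by_cases h : k = j
    · subst h; simp
    · simp [h]
  have hp : ∀ x y : Fin g → ℂ, cPair x y = x ⬝ᵥ y := fun _ _ => rfl
  simp only [thetaTerm]
  rw [hc, ← Complex.exp_add]
  congr 1
  simp only [hp]
  generalize (fun k => (m k : ℂ)) = v
  have h1 : (B *ᵥ v) ⬝ᵥ Pi.single j 1 = (B *ᵥ Pi.single j 1) ⬝ᵥ v := by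
    rw [dotProduct_comm, dotProduct_mulVec, ← mulVec_transpose, hB.eq]
  have h2 : (B *ᵥ Pi.single j 1) ⬝ᵥ Pi.single j 1 = B j j := by simp
  have h3 : z ⬝ᵥ Pi.single j 1 = z j := by simp
  rw [mulVec_add, add_dotProduct, add_dotProduct, dotProduct_add, dotProduct_add,
    dotProduct_add, h1, h2, h3]
  ring
end

section
/- Let τ ∈ ℂ with Im τ > 0. Then θ((1+τ)/2, τ) = 0, and this is the only zero of θ(·,τ) modulo the lattice ℤ + τℤ: for z ∈ ℂ, θ(z,τ) = 0 if and only if there exist integers m, n with z = (1+τ)/2 + m + nτ. -/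
open Complex Real

set_option autoImplicit false

open Filter Topology

/-- finite `q`-Pochhammer product -/
noncomputable def qpoch (p : ℂ) (n : ℕ) : ℂ := ∏ j ∈ Finset.range n, (1 - p ^ (j + 1))

/-- inverse `q`-Pochhammer, extended by zero to negative integers -/
noncomputable def qinv (p : ℂ) (n : ℤ) : ℂ := if 0 ≤ n then (qpoch p n.toNat)⁻¹ else 0

lemma one_sub_pow_ne {p : ℂ} (hp : ‖p‖ < 1) (j : ℕ) : 1 - p ^ (j + 1) ≠ 0 := by
  intro h
  have h1 : ‖p ^ (j + 1)‖ = 1 := by rw [← sub_eq_zero.mp h]; simp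
  rw [norm_pow] at h1
  have := pow_lt_one₀ (norm_nonneg p) hp (Nat.succ_ne_zero j)
  simp only [Nat.succ_eq_add_one] at this
  linarith

lemma qpoch_ne {p : ℂ} (hp : ‖p‖ < 1) (n : ℕ) : qpoch p n ≠ 0 :=
  Finset.prod_ne_zero_iff.mpr fun j _ => one_sub_pow_ne hp j

lemma qinv_rec {p : ℂ} (hp : ‖p‖ < 1) (n : ℤ) : qinv p (n - 1) = (1 - p ^ n) * qinv p n := by
  rcases lt_trichotomy n 0 with h | h | h
  · rw [qinv, qinv, if_neg (by omega), if_neg (by omega)]; simp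
  · subst h; simp [qinv]
  · obtain ⟨m, rfl⟩ : ∃ m : ℕ, n = m + 1 := ⟨(n - 1).toNat, by omega⟩
    rw [qinv, qinv, if_pos (by omega), if_pos (by omega)]
    have e1 : ((m : ℤ) + 1 - 1).toNat = m := by omega
    have e2 : ((m : ℤ) + 1).toNat = m + 1 := by omega
    rw [e1, e2]
    have e3 : qpoch p (m + 1) = qpoch p m * (1 - p ^ (m + 1)) := by
      simp [qpoch, Finset.prod_range_succ]
    have e4 : p ^ ((m : ℤ) + 1) = p ^ (m + 1) := by exact_mod_cast zpow_natCast p (m + 1)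
    rw [e3, e4]
    have := one_sub_pow_ne hp m
    have := qpoch_ne hp m
    field_simp

lemma finite_triple {q w : ℂ} (hq : ‖q‖ < 1) (hq0 : q ≠ 0) (hw : w ≠ 0) (N : ℕ) :
    HasSum (fun k : ℤ => qpoch (q ^ 2) (2 * N) * qinv (q ^ 2) (N + k) * qinv (q ^ 2) (N - k) *
      (q ^ (k ^ 2) * w ^ k))
      (∏ j ∈ Finset.range N, ((1 + q ^ (2 * j + 1) * w) * (1 + q ^ (2 * j + 1) * w⁻¹))) := by
  have hp : ‖q ^ 2‖ < 1 := by
    rw [norm_pow]; exact pow_lt_one₀ (norm_nonneg q) hq two_ne_zero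
  induction N with
  | zero =>
    have := hasSum_single (f := fun k : ℤ => qpoch (q ^ 2) (2 * 0) * qinv (q ^ 2) ((0 : ℕ) + k) *
      qinv (q ^ 2) ((0 : ℕ) - k) * (q ^ (k ^ 2) * w ^ k)) 0 (by
        intro k hk
        rcases lt_or_gt_of_ne hk with h | h
        · have : qinv (q ^ 2) ((0 : ℕ) + k) = 0 := by rw [qinv, if_neg (by simpa using h)]
          simp only [this]; simp
        · have : qinv (q ^ 2) ((0 : ℕ) - k) = 0 := by rw [qinv, if_neg (by simpa using h)]
          simp only [this]; simp)
    convert this using 1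
    simp [qpoch, qinv]
  | succ N ih =>
    rw [Finset.prod_range_succ]
    have h1 := ih.mul_right (1 + q ^ (4 * N + 2))
    have h2 := ((Equiv.subRight (1 : ℤ)).hasSum_iff.mpr ih).mul_right (q ^ (2 * N + 1) * w)
    have h3 := ((Equiv.addRight (1 : ℤ)).hasSum_iff.mpr ih).mul_right (q ^ (2 * N + 1) * w⁻¹)
    have h4 := (h1.add h2).add h3
    have hv : ∀ A : ℂ, A * ((1 + q ^ (2 * N + 1) * w) * (1 + q ^ (2 * N + 1) * w⁻¹)) =
        A * (1 + q ^ (4 * N + 2)) + A * (q ^ (2 * N + 1) * w) + A * (q ^ (2 * N + 1) * w⁻¹) := by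
      intro A
      field_simp
      ring
    rw [hv]
    refine Eq.mp (congrArg (fun f => HasSum f _) (funext fun k => Eq.symm ?_)) h4
    · simp only [Function.comp, Equiv.subRight_apply, Equiv.coe_addRight]
      set X : ℂ := (q ^ 2) ^ ((N : ℤ) + 1 + k) with hX
      set Y : ℂ := (q ^ 2) ^ ((N : ℤ) + 1 - k) with hY
      have hp0 : q ^ 2 ≠ 0 := pow_ne_zero 2 hq0
      set a := qinv (q ^ 2) ((N : ℤ) + 1 + k) with ha
      set b := qinv (q ^ 2) ((N : ℤ) + 1 - k) with hb
      have a1 : qinv (q ^ 2) ((N : ℤ) + k) = (1 - X) * a := by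
        rw [ha, hX, ← qinv_rec hp]; congr 1; ring
      have b1 : qinv (q ^ 2) ((N : ℤ) - k) = (1 - Y) * b := by
        rw [hb, hY, ← qinv_rec hp]; congr 1; ring
      have a2 : qinv (q ^ 2) ((N : ℤ) + (k - 1)) = (1 - X / q ^ 2) * ((1 - X) * a) := by
        rw [← a1, show (N : ℤ) + (k - 1) = (N + k) - 1 by ring, qinv_rec hp, hX,
          show (N : ℤ) + 1 + k = N + k + 1 by ring, zpow_add_one₀ hp0, mul_div_cancel_right₀ _ hp0]
      have b2 : qinv (q ^ 2) ((N : ℤ) - (k + 1)) = (1 - Y / q ^ 2) * ((1 - Y) * b) := by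
        rw [← b1, show (N : ℤ) - (k + 1) = (N - k) - 1 by ring, qinv_rec hp, hY,
          show (N : ℤ) + 1 - k = N - k + 1 by ring, zpow_add_one₀ hp0, mul_div_cancel_right₀ _ hp0]
      have a3 : qinv (q ^ 2) ((N : ℤ) + (k + 1)) = a := by rw [ha]; congr 1; ring
      have b3 : qinv (q ^ 2) ((N : ℤ) - (k - 1)) = b := by rw [hb]; congr 1; ring
      have tm : q ^ ((k - 1) ^ 2) * w ^ (k - 1) * (q ^ (2 * N + 1) * w) =
          Y * (q ^ (k ^ 2) * w ^ k) := by
        rw [zpow_sub_one₀ hw, hY, ← zpow_natCast q 2, ← zpow_mul, ← zpow_natCast q (2 * N + 1)]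
        have : q ^ ((k - 1) ^ 2) * q ^ ((2 * N + 1 : ℕ) : ℤ) =
            q ^ (((2 : ℕ) : ℤ) * ((N : ℤ) + 1 - k)) * q ^ (k ^ 2) := by
          rw [← zpow_add₀ hq0, ← zpow_add₀ hq0]; congr 1; push_cast; ring
        field_simp
        linear_combination this
      have tp : q ^ ((k + 1) ^ 2) * w ^ (k + 1) * (q ^ (2 * N + 1) * w⁻¹) =
          X * (q ^ (k ^ 2) * w ^ k) := by
        rw [zpow_add_one₀ hw, hX, ← zpow_natCast q 2, ← zpow_mul, ← zpow_natCast q (2 * N + 1)]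
        have : q ^ ((k + 1) ^ 2) * q ^ ((2 * N + 1 : ℕ) : ℤ) =
            q ^ (((2 : ℕ) : ℤ) * ((N : ℤ) + 1 + k)) * q ^ (k ^ 2) := by
          rw [← zpow_add₀ hq0, ← zpow_add₀ hq0]; congr 1; push_cast; ring
        field_simp
        linear_combination this
      have hXY : X * Y = (q ^ 2) ^ (2 * N + 2) := by
        rw [hX, hY, ← zpow_add₀ hp0, ← zpow_natCast (q ^ 2) (2 * N + 2)]; congr 1; push_cast; ring
      have hc : qpoch (q ^ 2) (2 * (N + 1)) =
          qpoch (q ^ 2) (2 * N) * (1 - X * Y / q ^ 2) * (1 - X * Y) := by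
        rw [hXY, show 2 * (N + 1) = 2 * N + 1 + 1 by ring, qpoch, Finset.prod_range_succ,
          Finset.prod_range_succ, ← qpoch, pow_succ _ (2 * N + 1), mul_div_cancel_right₀ _ hp0]
      have hd : q ^ (4 * N + 2) = X * Y / q ^ 2 := by
        rw [hXY]; field_simp; ring
      push_cast
      rw [a1, b1, a2, b2, a3, b3, hc, hd, mul_assoc _ (q ^ ((k - 1) ^ 2) * w ^ (k - 1)), tm,
        mul_assoc _ (q ^ ((k + 1) ^ 2) * w ^ (k + 1)), tp]
      field_simp
      ring

lemma summ_aux {q : ℂ} (hq : ‖q‖ < 1) (w : ℂ) : Summable fun j : ℕ => ‖q ^ (2 * j + 1) * w‖ := by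
  have h : ‖q‖ ^ 2 < 1 := pow_lt_one₀ (norm_nonneg q) hq two_ne_zero
  have := (summable_geometric_of_lt_one (by positivity) h).mul_right (‖q‖ * ‖w‖)
  refine this.congr fun j => ?_
  rw [norm_mul, norm_pow, pow_succ _ (2 * j), pow_mul]; ring

lemma qpoch_tendsto {p : ℂ} (hp : ‖p‖ < 1) :
    ∃ L : ℂ, L ≠ 0 ∧ Tendsto (qpoch p) atTop (𝓝 L) := by
  have hs : Summable fun j : ℕ => ‖-p ^ (j + 1)‖ := by
    simpa using (summable_nat_add_iff 1).mpr (summable_geometric_of_lt_one (norm_nonneg _) hp)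
  refine ⟨∏' j : ℕ, (1 + -p ^ (j + 1)), tprod_one_add_ne_zero_of_summable (fun j => ?_) hs, ?_⟩
  · rw [← sub_eq_add_neg]; exact one_sub_pow_ne hp j
  · have := (multipliable_one_add_of_summable hs).tendsto_prod_tprod_nat
    refine this.congr fun n => ?_
    simp [qpoch, sub_eq_add_neg]

lemma bdd_of_tendsto {u : ℕ → ℂ} {L : ℂ} (h : Tendsto u atTop (𝓝 L)) :
    ∃ C : ℝ, 0 ≤ C ∧ ∀ n, ‖u n‖ ≤ C := by
  obtain ⟨C, hC⟩ := (Metric.isBounded_range_of_tendsto u h).exists_norm_le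
  exact ⟨C, (norm_nonneg _).trans (hC (u 0) ⟨0, rfl⟩), fun n => hC _ ⟨n, rfl⟩⟩

lemma qinv_tendsto {p L : ℂ} (hL : L ≠ 0) (h : Tendsto (qpoch p) atTop (𝓝 L)) (k : ℤ) :
    Tendsto (fun N : ℕ => qinv p (N + k)) atTop (𝓝 L⁻¹) := by
  have h1 : Tendsto (fun N : ℕ => ((N : ℤ) + k).toNat) atTop atTop := by
    rw [tendsto_atTop]
    intro b
    filter_upwards [eventually_ge_atTop (b + k.natAbs)] with N hN
    omega
  refine ((h.comp h1).inv₀ hL).congr' ?_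
  filter_upwards [eventually_ge_atTop k.natAbs] with N hN
  rw [qinv, if_pos (by omega)]; rfl

lemma triple {q w : ℂ} (hq : ‖q‖ < 1) (hq0 : q ≠ 0) (hw : w ≠ 0)
    (hs : Summable fun k : ℤ => ‖q ^ (k ^ 2) * w ^ k‖) :
    ∃ L : ℂ, L ≠ 0 ∧ Tendsto (fun N : ℕ => ∏ j ∈ Finset.range N,
      ((1 + q ^ (2 * j + 1) * w) * (1 + q ^ (2 * j + 1) * w⁻¹))) atTop
      (𝓝 (L * ∑' k : ℤ, q ^ (k ^ 2) * w ^ k)) := by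
  have hp : ‖q ^ 2‖ < 1 := by
    rw [norm_pow]; exact pow_lt_one₀ (norm_nonneg q) hq two_ne_zero
  obtain ⟨L, hL, hT⟩ := qpoch_tendsto hp
  obtain ⟨C, hC0, hC⟩ := bdd_of_tendsto hT
  obtain ⟨D, hD0, hD⟩ := bdd_of_tendsto (hT.inv₀ hL)
  have hD' : ∀ n : ℤ, ‖qinv (q ^ 2) n‖ ≤ D := by
    intro n
    rw [qinv]
    split_ifs
    · exact hD _
    · simpa using hD0
  refine ⟨L * L⁻¹ * L⁻¹, by simp [hL], ?_⟩
  rw [← tsum_mul_left]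
  have key : Tendsto (fun N : ℕ => ∑' k : ℤ, qpoch (q ^ 2) (2 * N) * qinv (q ^ 2) (N + k) *
      qinv (q ^ 2) (N - k) * (q ^ (k ^ 2) * w ^ k)) atTop
      (𝓝 (∑' k : ℤ, L * L⁻¹ * L⁻¹ * (q ^ (k ^ 2) * w ^ k))) := by
    refine tendsto_tsum_of_dominated_convergence (hs.mul_left (C * D * D)) ?_ ?_
    · intro k
      refine Tendsto.mul_const _ (Tendsto.mul (Tendsto.mul ?_ (qinv_tendsto hL hT k)) ?_)
      · exact hT.comp (tendsto_id.const_mul_atTop' two_pos)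
      · simpa [sub_eq_add_neg] using qinv_tendsto hL hT (-k)
    · refine Eventually.of_forall fun N k => ?_
      rw [norm_mul, norm_mul _ (qinv _ _), norm_mul _ (qinv _ _)]
      gcongr
      · exact hC _
      · exact hD' _
      · exact hD' _
  exact key.congr fun N => (finite_triple hq hq0 hw N).tsum_eq

lemma zero_iff {q w : ℂ} (hq : ‖q‖ < 1) (hq0 : q ≠ 0) (hw : w ≠ 0)
    (hs : Summable fun k : ℤ => ‖q ^ (k ^ 2) * w ^ k‖) :
    ∑' k : ℤ, q ^ (k ^ 2) * w ^ k = 0 ↔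
      ∃ j : ℕ, 1 + q ^ (2 * j + 1) * w = 0 ∨ 1 + q ^ (2 * j + 1) * w⁻¹ = 0 := by
  obtain ⟨L, hL, hT⟩ := triple hq hq0 hw hs
  constructor
  · intro h
    by_contra! hne
    rw [h, mul_zero] at hT
    simp only [Finset.prod_mul_distrib] at hT
    have h1 := (multipliable_one_add_of_summable (summ_aux hq w)).tendsto_prod_tprod_nat
    have h2 := (multipliable_one_add_of_summable (summ_aux hq w⁻¹)).tendsto_prod_tprod_nat
    have h3 := tendsto_nhds_unique hT (h1.mul h2)
    exact mul_ne_zero (tprod_one_add_ne_zero_of_summable (fun j => (hne j).1) (summ_aux hq w))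
      (tprod_one_add_ne_zero_of_summable (fun j => (hne j).2) (summ_aux hq w⁻¹)) h3.symm
  · rintro ⟨j, hj⟩
    have h0 : Tendsto (fun N : ℕ => ∏ j ∈ Finset.range N,
      ((1 + q ^ (2 * j + 1) * w) * (1 + q ^ (2 * j + 1) * w⁻¹))) atTop (𝓝 0) := by
      refine tendsto_const_nhds.congr' ?_
      filter_upwards [eventually_gt_atTop j] with N hN
      refine (Finset.prod_eq_zero (Finset.mem_range.mpr hN) ?_).symm
      rcases hj with hj | hj <;> simp [hj]
    exact (mul_eq_zero.mp (tendsto_nhds_unique hT h0)).resolve_left hL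

lemma exp_aux (x : ℂ) : 1 + cexp (π * I * x) = 0 ↔ ∃ m : ℤ, x = 1 + 2 * m := by
  rw [add_comm, add_eq_zero_iff_eq_neg, ← Complex.exp_pi_mul_I, Complex.exp_eq_exp_iff_exists_int]
  have hpi : (π : ℂ) * I ≠ 0 := by simp [Real.pi_ne_zero]
  refine exists_congr fun m => ?_
  constructor
  · intro h
    apply mul_left_cancel₀ hpi
    linear_combination h
  · rintro rfl
    ring

lemma theta_zero_iff (τ : ℂ) (hτ : 0 < τ.im) (z : ℂ) : jacobiTheta₂ z τ = 0 ↔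
      ∃ m n : ℤ, z = (1 + τ) / 2 + (m : ℂ) + (n : ℂ) * τ := by
  have ht : ∀ k : ℤ, jacobiTheta₂_term k z τ =
      cexp (π * I * τ) ^ (k ^ 2) * cexp (2 * π * I * z) ^ k := by
    intro k
    rw [jacobiTheta₂_term, ← Complex.exp_int_mul, ← Complex.exp_int_mul, ← Complex.exp_add]
    congr 1; push_cast; ring
  have hs := ((summable_jacobiTheta₂_term_iff z τ).mpr hτ).norm
  simp only [ht] at hs
  have hq : ‖cexp (π * I * τ)‖ < 1 := by
    rw [Complex.norm_exp, Real.exp_lt_one_iff]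
    simp
    positivity
  rw [jacobiTheta₂]
  simp only [ht]
  rw [zero_iff hq (Complex.exp_ne_zero _) (Complex.exp_ne_zero _) hs]
  have e1 : ∀ j : ℕ, cexp (π * I * τ) ^ (2 * j + 1) * cexp (2 * π * I * z) =
      cexp (π * I * ((2 * j + 1) * τ + 2 * z)) := by
    intro j
    rw [← Complex.exp_nat_mul, ← Complex.exp_add]; congr 1; push_cast; ring
  have e2 : ∀ j : ℕ, cexp (π * I * τ) ^ (2 * j + 1) * (cexp (2 * π * I * z))⁻¹ =
      cexp (π * I * ((2 * j + 1) * τ - 2 * z)) := by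
    intro j
    rw [← Complex.exp_nat_mul, ← Complex.exp_neg, ← Complex.exp_add]; congr 1; push_cast; ring
  simp only [e1, e2, exp_aux]
  constructor
  · rintro ⟨j, ⟨m, h⟩ | ⟨m, h⟩⟩
    · refine ⟨m, -j - 1, ?_⟩
      push_cast
      linear_combination h / 2
    · refine ⟨-m - 1, j, ?_⟩
      push_cast
      linear_combination -h / 2
  · rintro ⟨m, n, rfl⟩
    rcases le_or_gt 0 n with h | h
    · lift n to ℕ using h
      refine ⟨n, Or.inr ⟨-m - 1, ?_⟩⟩
      push_cast
      ring
    · obtain ⟨j, rfl⟩ : ∃ j : ℕ, n = -j - 1 := ⟨(-n - 1).toNat, by omega⟩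
      refine ⟨j, Or.inl ⟨m, ?_⟩⟩
      push_cast
      ring

/-- for `Im τ > 0`, `θ((1+τ)/2, τ) = 0`, and this is the only
zero of `θ(·,τ)` modulo the lattice `ℤ + τℤ`. -/
theorem jacobiTheta₂_zeros (τ : ℂ) (hτ : 0 < τ.im) :
    jacobiTheta₂ ((1 + τ) / 2) τ = 0 ∧
    ∀ z : ℂ, jacobiTheta₂ z τ = 0 ↔
      ∃ m n : ℤ, z = (1 + τ) / 2 + (m : ℂ) + (n : ℂ) * τ :=
  ⟨(theta_zero_iff τ hτ _).mpr ⟨0, 0, by simp⟩, theta_zero_iff τ hτ⟩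
end
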